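/- arXiv:2005.14493 — 6 statements merged into one kernel-verified Lean document; each statement's English description precedes it below -/
import Mathlib

section
/- Let Σ=(𝒰,𝒮) be a set system with |𝒰| = m ≥ 2, let 𝒞 ⊆ 𝒮 together with an assignment φ be a stable set-cover solution on Σ, and let 𝒞* ⊆ 𝒮 be any set-cover solution of minimum size. Then |𝒞| ≤ (2 + 2·log₂ m) · |𝒞*|. -/
open scoped Classical

/-- A set covered by `D`, each of whose members meets it in at most `k` elements, has at most
`D.card * k` elements. -/
theorem card_le_card_mul_of_cover {α : Type*} (A : Finset α) (D : Finset (Finset α)) (k : ℕ)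
    (hcover : ∀ u ∈ A, ∃ T ∈ D, u ∈ T) (hk : ∀ T ∈ D, (T ∩ A).card ≤ k) :
    A.card ≤ D.card * k := by
  have hsub : A ⊆ D.biUnion (fun T => T ∩ A) := by
    intro u hu
    obtain ⟨T, hT, huT⟩ := hcover u hu
    exact Finset.mem_biUnion.2 ⟨T, hT, Finset.mem_inter.2 ⟨huT, hu⟩⟩
  exact (Finset.card_le_card hsub).trans (Finset.card_biUnion_le_card_mul _ _ _ hk)

/-- Any stable set-cover solution `C` on a set system `(U, S)` with
`|U| = m ≥ 2` is a `(2 + 2·log₂ m)`-approximation of any minimum set-cover solution `Copt`.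

The assignment `φ` maps each element `u ∈ U` to a set of `C` containing `u`; the cover set of
`T` is `cov T = {u ∈ U : φ u = T}`.  The level of a set `T ∈ C` (whose cover set is nonempty by
stability condition (1)) is the unique `j` with `2^j ≤ |cov T| < 2^{j+1}`, i.e.
`Nat.log 2 (cov T).card`, and `A_j = {u ∈ U : level (φ u) = j}`.  Stability condition (2) says
that no `T ∈ S` satisfies `|T ∩ A_j| ≥ 2^{j+1}`. -/
theorem stable_set_cover_approximation
    {α : Type*} (U : Finset α) (S C Copt : Finset (Finset α))
    (m : ℕ) (hm : U.card = m) (hm2 : 2 ≤ m)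
    -- set system: sets of `S` are subsets of `U` whose union is `U`
    (hS : ∀ T ∈ S, T ⊆ U) (hSU : ∀ u ∈ U, ∃ T ∈ S, u ∈ T)
    -- `C` is a set-cover solution with assignment `φ`
    (hCS : C ⊆ S) (φ : α → Finset α)
    (hφC : ∀ u ∈ U, φ u ∈ C) (hφmem : ∀ u ∈ U, u ∈ φ u)
    (cov : Finset α → Finset α)
    (hcov : ∀ T : Finset α, cov T = U.filter (fun u => φ u = T))
    -- stability condition (1): every set of `C` has a nonempty cover set
    (hstable₁ : ∀ T ∈ C, (cov T).Nonempty)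
    -- stability condition (2): for every level `j`, no `T ∈ S` has `|T ∩ A_j| ≥ 2^{j+1}`
    (hstable₂ : ∀ j : ℕ, ∀ T ∈ S,
      (T ∩ U.filter (fun u => Nat.log 2 (cov (φ u)).card = j)).card < 2 ^ (j + 1))
    -- `Copt` is a set-cover solution of minimum size
    (hCoptS : Copt ⊆ S) (hCoptCov : ∀ u ∈ U, ∃ T ∈ Copt, u ∈ T)
    (hCoptMin : ∀ C' ⊆ S, (∀ u ∈ U, ∃ T ∈ C', u ∈ T) → Copt.card ≤ C'.card) :
    (C.card : ℝ) ≤ (2 + 2 * Real.logb 2 m) * Copt.card := by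
  have hlevel : ∀ j : ℕ, (C.filter (fun T => Nat.log 2 (cov T).card = j)).card
      ≤ 2 * Copt.card := by
    intro j
    set A := U.filter (fun u => Nat.log 2 (cov (φ u)).card = j) with hA
    have hupper : A.card ≤ Copt.card * 2 ^ (j + 1) :=
      card_le_card_mul_of_cover A Copt _
        (fun u hu => hCoptCov u (Finset.mem_filter.1 hu).1)
        (fun T hT => (hstable₂ j T (hCoptS hT)).le)
    have hlower : (C.filter (fun T => Nat.log 2 (cov T).card = j)).card * 2 ^ j ≤ A.card := by
      rw [← smul_eq_mul, Finset.card_eq_sum_card_fiberwise (f := φ) (s := A)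
        (t := C.filter (fun T => Nat.log 2 (cov T).card = j))]
      · refine Finset.card_nsmul_le_sum _ _ _ fun T hT => ?_
        obtain ⟨hTC, rfl⟩ := Finset.mem_filter.1 hT
        refine (Nat.pow_log_le_self 2 (hstable₁ T hTC).card_pos.ne').trans
          (Finset.card_le_card fun u hu => ?_)
        rw [hcov, Finset.mem_filter] at hu
        simp [hA, hu.1, hu.2]
      · intro u hu
        obtain ⟨huU, huj⟩ := Finset.mem_filter.1 hu
        exact Finset.mem_filter.2 ⟨hφC u huU, huj⟩
    have hpow : 0 < 2 ^ j := by positivity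
    refine Nat.le_of_mul_le_mul_right (hlower.trans (hupper.trans_eq ?_)) hpow
    ring
  have hmaps : ∀ T ∈ C, Nat.log 2 (cov T).card ∈ Finset.range (Nat.log 2 m + 1) := by
    intro T _
    rw [Finset.mem_range, Nat.lt_succ_iff, ← hm, hcov]
    exact Nat.log_mono_right (Finset.card_le_card (Finset.filter_subset _ _))
  have hcard : C.card ≤ 2 * Copt.card * (Nat.log 2 m + 1) := by
    simpa using Finset.card_le_mul_card_image_of_maps_to hmaps _ (fun j _ => hlevel j)
  have hlog : (Nat.log 2 m : ℝ) ≤ Real.logb 2 m := by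
    exact_mod_cast Real.natLog_le_logb m 2
  calc (C.card : ℝ) ≤ 2 * Copt.card * (Nat.log 2 m + 1) := by exact_mod_cast hcard
    _ ≤ 2 * Copt.card * (Real.logb 2 m + 1) := by gcongr
    _ = (2 + 2 * Real.logb 2 m) * Copt.card := by ring
end

section
/- Let Σ=(𝒰,𝒮) be a set system, let 𝒞 ⊆ 𝒮 with assignment φ be a set-cover solution in which cov(S) ≠ ∅ for every S ∈ 𝒞, and let j be a level index such that no T ∈ 𝒮 satisfies |T ∩ A_j| ≥ 2^{j+1}. Then every set-cover solution 𝒞* ⊆ 𝒮 satisfies |𝒞*| ≥ |A_j| / 2^{j+1}, and consequently the number of sets of 𝒞 at level j is at most 2 · |𝒞*|. -/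
open scoped Classical

/-- Let `(U, S)` be a set system, let `C ⊆ S` with assignment `φ` be a
set-cover solution in which every set of `C` has a nonempty cover set, and let `j` be a level
index such that no `T ∈ S` satisfies `|T ∩ A_j| ≥ 2^{j+1}`.  Then every set-cover solution
`Copt ⊆ S` satisfies `|Copt| ≥ |A_j| / 2^{j+1}`, and consequently the number of sets of `C` at
level `j` is at most `2 · |Copt|`.

The level of `T ∈ C` (with nonempty cover set) is the unique `j` with
`2^j ≤ |cov T| < 2^{j+1}`, i.e. `Nat.log 2 (cov T).card`, and
`A_j = {u ∈ U : level (φ u) = j}`. -/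
theorem level_j_sets_bound
    {α : Type*} (U : Finset α) (S C Copt : Finset (Finset α))
    -- set system: sets of `S` are subsets of `U` whose union is `U`
    (hS : ∀ T ∈ S, T ⊆ U) (hSU : ∀ u ∈ U, ∃ T ∈ S, u ∈ T)
    -- `C` is a set-cover solution with assignment `φ`
    (hCS : C ⊆ S) (φ : α → Finset α)
    (hφC : ∀ u ∈ U, φ u ∈ C) (hφmem : ∀ u ∈ U, u ∈ φ u)
    (cov : Finset α → Finset α)
    (hcov : ∀ T : Finset α, cov T = U.filter (fun u => φ u = T))
    -- every set of `C` has a nonempty cover set (so its level is well defined)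
    (hne : ∀ T ∈ C, (cov T).Nonempty)
    -- no `T ∈ S` satisfies `|T ∩ A_j| ≥ 2^{j+1}`
    (j : ℕ)
    (hstable : ∀ T ∈ S,
      (T ∩ U.filter (fun u => Nat.log 2 (cov (φ u)).card = j)).card < 2 ^ (j + 1))
    -- `Copt` is any set-cover solution
    (hCoptS : Copt ⊆ S) (hCoptCov : ∀ u ∈ U, ∃ T ∈ Copt, u ∈ T) :
    ((U.filter (fun u => Nat.log 2 (cov (φ u)).card = j)).card : ℝ) / 2 ^ (j + 1)
        ≤ Copt.card ∧
      (C.filter (fun T => Nat.log 2 (cov T).card = j)).card ≤ 2 * Copt.card := by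
  set A := U.filter (fun u => Nat.log 2 (cov (φ u)).card = j)
  set L := C.filter (fun T => Nat.log 2 (cov T).card = j)
  have hAcard : A.card ≤ Copt.card * 2 ^ (j + 1) := by
    have hsub : A ⊆ Copt.biUnion (fun T => T ∩ A) := by
      intro u hu
      obtain ⟨T, hT, huT⟩ := hCoptCov u (Finset.mem_filter.mp hu).1
      exact Finset.mem_biUnion.mpr ⟨T, hT, Finset.mem_inter.mpr ⟨huT, hu⟩⟩
    exact (Finset.card_le_card hsub).trans
      (Finset.card_biUnion_le_card_mul _ _ _ fun T hT => (hstable T (hCoptS hT)).le)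
  have hLcard : L.card * 2 ^ j ≤ A.card := by
    have hmaps : ∀ u ∈ A, φ u ∈ L := fun u hu =>
      Finset.mem_filter.mpr
        ⟨hφC u (Finset.mem_filter.mp hu).1, (Finset.mem_filter.mp hu).2⟩
    rw [Finset.card_eq_sum_card_fiberwise hmaps, ← smul_eq_mul]
    refine Finset.card_nsmul_le_sum _ _ _ fun T hT => ?_
    obtain ⟨hTC, hTj⟩ := Finset.mem_filter.mp hT
    have hpow : 2 ^ j ≤ (cov T).card :=
      hTj ▸ Nat.pow_log_le_self 2 (Finset.card_pos.mpr (hne T hTC)).ne'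
    refine hpow.trans (Finset.card_le_card fun u hu => ?_)
    rw [hcov T, Finset.mem_filter] at hu
    obtain ⟨huU, rfl⟩ := hu
    exact Finset.mem_filter.mpr ⟨Finset.mem_filter.mpr ⟨huU, hTj⟩, rfl⟩
  refine ⟨?_, ?_⟩
  · rw [div_le_iff₀ (by positivity)]
    exact_mod_cast hAcard
  · refine Nat.le_of_mul_le_mul_right (c := 2 ^ j) ?_ (by positivity)
    calc L.card * 2 ^ j ≤ Copt.card * 2 ^ (j + 1) := hLcard.trans hAcard
      _ = 2 * Copt.card * 2 ^ j := by ring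
end

section
/- Let 𝒰 be a finite set and 𝒮 a collection of subsets of 𝒰 whose union is 𝒰. Let S₁,…,S_T ∈ 𝒮 be a greedy run, i.e., with cover sets defined recursively by cov(S_i) = S_i \ (cov(S₁) ∪ ⋯ ∪ cov(S_{i-1})), assume that each cov(S_i) is nonempty, that cov(S₁) ∪ ⋯ ∪ cov(S_T) = 𝒰, and that the greedy choice property holds: for every i ∈ {1,…,T} and every T' ∈ 𝒮, |cov(S_i)| ≥ |T' \ (cov(S₁) ∪ ⋯ ∪ cov(S_{i-1}))|. For each i let j_i be the unique integer with 2^{j_i} ≤ |cov(S_i)| < 2^{j_i+1}, and for each j let A_j = ⋃_{i : j_i = j} cov(S_i). Then for every level index j there is no T' ∈ 𝒮 with |T' ∩ A_j| ≥ 2^{j+1}; that is, the set-cover solution 𝒞 = {S₁,…,S_T} produced by the greedy algorithm (with each u ∈ 𝒰 assigned to the unique S_i with u ∈ cov(S_i)) is stable. -/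
open scoped Classical

/-- The set-cover solution produced by the greedy algorithm is stable.

`seq 0, …, seq (T-1) ∈ S` is a greedy run: the cover sets satisfy
`cov i = seq i \ (cov 0 ∪ ⋯ ∪ cov (i-1))`, each `cov i` is nonempty, the cover sets together
cover `U`, and the greedy choice property holds: for every `i` and every `T' ∈ S`,
`|cov i| ≥ |T' \ (cov 0 ∪ ⋯ ∪ cov (i-1))|`.  For each `i`, `j_i = Nat.log 2 (cov i).card` is
the unique integer with `2^{j_i} ≤ |cov i| < 2^{j_i+1}`, and `A_j = ⋃_{i : j_i = j} cov i`.
Then for every level `j` there is no `T' ∈ S` with `|T' ∩ A_j| ≥ 2^{j+1}`. -/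
theorem greedy_solution_is_stable
    {α : Type*} [DecidableEq α] (U : Finset α) (S : Finset (Finset α))
    -- set system: sets of `S` are subsets of `U` whose union is `U`
    (hS : ∀ T ∈ S, T ⊆ U) (hSU : ∀ u ∈ U, ∃ T ∈ S, u ∈ T)
    (T : ℕ) (seq : Fin T → Finset α) (hseq : ∀ i, seq i ∈ S)
    (cov : Fin T → Finset α)
    -- recursive definition of the cover sets
    (hcov : ∀ i, cov i = seq i \ (Finset.Iio i).biUnion cov)
    -- each cover set is nonempty
    (hne : ∀ i, (cov i).Nonempty)
    -- the cover sets together cover `U`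
    (hcover : ∀ u ∈ U, ∃ i, u ∈ cov i)
    -- greedy choice property
    (hgreedy : ∀ i, ∀ T' ∈ S,
      (T' \ (Finset.Iio i).biUnion cov).card ≤ (cov i).card)
    (j : ℕ) (T' : Finset α) (hT' : T' ∈ S) :
    (T' ∩ (Finset.univ.filter
        (fun i : Fin T => Nat.log 2 (cov i).card = j)).biUnion cov).card < 2 ^ (j + 1) := by
  set L := Finset.univ.filter (fun i : Fin T => Nat.log 2 (cov i).card = j)
  rcases L.eq_empty_or_nonempty with hempty | hnonempty
  · simp [hempty]
  -- the first index `i` of level `j`: no element of level `j` is covered before step `i`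
  obtain ⟨i, hiL, hmin⟩ := L.exists_min_image id hnonempty
  have hsub : T' ∩ L.biUnion cov ⊆ T' \ (Finset.Iio i).biUnion cov := by
    intro x hx
    obtain ⟨hxT', hxL⟩ := Finset.mem_inter.mp hx
    obtain ⟨k, hkL, hxk⟩ := Finset.mem_biUnion.mp hxL
    rw [hcov k] at hxk
    refine Finset.mem_sdiff.mpr ⟨hxT', fun hxi => (Finset.mem_sdiff.mp hxk).2 ?_⟩
    exact Finset.biUnion_subset_biUnion_of_subset_left cov
      (Finset.Iio_subset_Iio (hmin k hkL)) hxi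
  have hlevel : Nat.log 2 (cov i).card = j := (Finset.mem_filter.mp hiL).2
  calc (T' ∩ L.biUnion cov).card
      ≤ (T' \ (Finset.Iio i).biUnion cov).card := Finset.card_le_card hsub
    _ ≤ (cov i).card := hgreedy i T' hT'
    _ < 2 ^ (j + 1) := hlevel ▸ Nat.lt_pow_succ_log_self Nat.one_lt_two _
end

section
/- Let P ⊆ [0,1]^d be a finite set with |P| ≥ k ≥ 1, let Q ⊆ P be nonempty, let ε ∈ [0,1], and let c = min_{i∈{1,…,d}} ω_k(e_i, P) where e_1,…,e_d is the standard basis of ℝ^d. Suppose that for every i ∈ {1,…,d} there exists q ∈ Q with ⟨e_i, q⟩ ≥ (1−ε)·ω_k(e_i, P). Then for every u ∈ 𝕌 with ω_k(u, P) ≤ c/√d, it holds that max_{q∈Q} ⟨u,q⟩ ≥ (1−ε)·ω_k(u, P). -/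
open scoped RealInnerProductSpace Classical

/-- `omegaK k u P` is the `k`-th largest value (counted with multiplicity) among the scores
`⟨u, p⟩` for `p ∈ P`; equivalently, the largest `s` such that at least `k` points `p ∈ P`
satisfy `⟨u, p⟩ ≥ s`. -/
noncomputable def omegaK {d : ℕ} (k : ℕ) (u : EuclideanSpace ℝ (Fin d))
    (P : Finset (EuclideanSpace ℝ (Fin d))) : ℝ :=
  sSup {s : ℝ | k ≤ (P.filter (fun p => s ≤ ⟪u, p⟫)).card}

/-- A nonnegative unit vector of `ℝ^d` has a coordinate that is at least `1 / √d`. -/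
lemma exists_inv_sqrt_le_coord {d : ℕ} (hd : 0 < d) (u : EuclideanSpace ℝ (Fin d))
    (hu_nonneg : ∀ i, 0 ≤ u i) (hu_norm : ‖u‖ = 1) : ∃ i, (√(d : ℝ))⁻¹ ≤ u i := by
  by_contra! h
  have hd' : (d : ℝ) ≠ 0 := by positivity
  have hsum : ∑ i, u i ^ 2 = 1 := by
    rw [← EuclideanSpace.real_norm_sq_eq, hu_norm, one_pow]
  have hlt : ∑ i, u i ^ 2 < ∑ _i : Fin d, (d : ℝ)⁻¹ := by
    refine Finset.sum_lt_sum_of_nonempty ⟨⟨0, hd⟩, Finset.mem_univ _⟩ fun i _ => ?_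
    calc u i ^ 2 < (√(d : ℝ))⁻¹ ^ 2 := pow_lt_pow_left₀ (h i) (hu_nonneg i) two_ne_zero
      _ = (d : ℝ)⁻¹ := by rw [inv_pow, Real.sq_sqrt d.cast_nonneg]
  simp [hsum, hd'] at hlt

/-- For nonnegative vectors, each coordinate product is at most the inner product. -/
lemma coord_mul_le_inner {d : ℕ} (u q : EuclideanSpace ℝ (Fin d))
    (hu : ∀ i, 0 ≤ u i) (hq : ∀ i, 0 ≤ q i) (i : Fin d) : u i * q i ≤ ⟪u, q⟫ := by
  rw [PiLp.inner_apply]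
  simp only [RCLike.inner_apply, conj_trivial, mul_comm (q _)]
  exact Finset.single_le_sum (f := fun j => u j * q j)
    (fun j _ => mul_nonneg (hu j) (hq j)) (Finset.mem_univ i)

/-- **Case 1.** Let `P ⊆ [0,1]^d` be finite with `|P| ≥ k ≥ 1`, let `Q ⊆ P` be
nonempty, let `ε ∈ [0,1]`, and let `c = min_i ω_k(e_i, P)` where `e_1, …, e_d` is the standard
basis.  If for every `i` there exists `q ∈ Q` with `⟨e_i, q⟩ ≥ (1−ε)·ω_k(e_i, P)`, then for
every `u ∈ 𝕌` with `ω_k(u, P) ≤ c/√d` it holds that `max_{q∈Q} ⟨u,q⟩ ≥ (1−ε)·ω_k(u, P)`. -/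
theorem regret_bound_small_score_case
    {d : ℕ} (hd : 0 < d) (k : ℕ) (hk : 1 ≤ k)
    (P Q : Finset (EuclideanSpace ℝ (Fin d)))
    (hPk : k ≤ P.card)
    (hP : ∀ p ∈ P, ∀ i, 0 ≤ p i ∧ p i ≤ 1)
    (hQP : Q ⊆ P) (hQ : Q.Nonempty)
    (ε : ℝ) (hε₀ : 0 ≤ ε) (hε₁ : ε ≤ 1)
    (c : ℝ)
    (hc : c = Finset.univ.inf' (Finset.univ_nonempty_iff.mpr ⟨⟨0, hd⟩⟩)
      (fun i => omegaK k (EuclideanSpace.single i 1) P))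
    (hbasis : ∀ i : Fin d, ∃ q ∈ Q,
      (1 - ε) * omegaK k (EuclideanSpace.single i 1) P ≤
        ⟪(EuclideanSpace.single i 1 : EuclideanSpace ℝ (Fin d)), q⟫)
    (u : EuclideanSpace ℝ (Fin d)) (hu_nonneg : ∀ i, 0 ≤ u i) (hu_norm : ‖u‖ = 1)
    (hsmall : omegaK k u P ≤ c / Real.sqrt d) :
    (1 - ε) * omegaK k u P ≤ Q.sup' hQ (fun q => ⟪u, q⟫) := by
  obtain ⟨i, hi⟩ := exists_inv_sqrt_le_coord hd u hu_nonneg hu_norm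
  obtain ⟨q, hqQ, hq⟩ := hbasis i
  have hq_nonneg : ∀ j, 0 ≤ q j := fun j => (hP q (hQP hqQ) j).1
  have hci : c ≤ omegaK k (EuclideanSpace.single i 1) P :=
    hc.trans_le (Finset.inf'_le _ (Finset.mem_univ i))
  have hqi : (1 - ε) * omegaK k (EuclideanSpace.single i 1) P ≤ q i := by
    simpa [EuclideanSpace.inner_single_left] using hq
  have hε : 0 ≤ 1 - ε := sub_nonneg.mpr hε₁
  calc (1 - ε) * omegaK k u P ≤ (1 - ε) * (c / √(d : ℝ)) := by gcongr
    _ = (√(d : ℝ))⁻¹ * ((1 - ε) * c) := by ring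
    _ ≤ (√(d : ℝ))⁻¹ * q i := by
      gcongr
      exact (mul_le_mul_of_nonneg_left hci hε).trans hqi
    _ ≤ u i * q i := mul_le_mul_of_nonneg_right hi (hq_nonneg i)
    _ ≤ ⟪u, q⟫ := coord_mul_le_inner u q hu_nonneg hq_nonneg i
    _ ≤ Q.sup' hQ (fun q => ⟪u, q⟫) := Finset.le_sup' (fun q => ⟪u, q⟫) hqQ
end

section
/- Let P ⊆ [0,1]^d be a finite set with |P| ≥ k ≥ 1, let ε ∈ [0,1], δ ≥ 0 and c > 0, and let u, ū ∈ 𝕌 with ‖ū − u‖ ≤ δ. Suppose ω_k(u, P) > c/√d and suppose q ∈ P satisfies ⟨ū, q⟩ ≥ (1−ε)·ω_k(ū, P). Then ⟨u, q⟩ ≥ (1 − ε − 2dδ/c) · ω_k(u, P). -/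
open scoped RealInnerProductSpace Classical

theorem bddAbove_setOf_le_card_filter {d k : ℕ} (hk : 1 ≤ k) (u : EuclideanSpace ℝ (Fin d))
    (P : Finset (EuclideanSpace ℝ (Fin d))) :
    BddAbove {s : ℝ | k ≤ (P.filter (fun p => s ≤ ⟪u, p⟫)).card} := by
  obtain ⟨M, hM⟩ := (P.image fun p => ⟪u, p⟫).bddAbove
  refine ⟨M, fun s hs => ?_⟩
  obtain ⟨p, hp⟩ := Finset.card_pos.1 (lt_of_lt_of_le hk hs)
  rw [Finset.mem_filter] at hp
  exact hp.2.trans (hM (Finset.mem_coe.2 (Finset.mem_image_of_mem _ hp.1)))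

theorem nonempty_setOf_le_card_filter {d k : ℕ} (u : EuclideanSpace ℝ (Fin d))
    {P : Finset (EuclideanSpace ℝ (Fin d))} (hPk : k ≤ P.card) :
    {s : ℝ | k ≤ (P.filter (fun p => s ≤ ⟪u, p⟫)).card}.Nonempty := by
  obtain ⟨m, hm⟩ := (P.image fun p => ⟪u, p⟫).bddBelow
  refine ⟨m, ?_⟩
  rw [Set.mem_ofPred_eq, Finset.filter_true_of_mem]
  · exact hPk
  · exact fun p hp => hm (Finset.mem_coe.2 (Finset.mem_image_of_mem _ hp))

/-- If every score drops by at most `η` when passing from `u` to `v`, so does the `k`-th largest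
score. -/
theorem omegaK_sub_le_omegaK {d k : ℕ} (hk : 1 ≤ k) {P : Finset (EuclideanSpace ℝ (Fin d))}
    (hPk : k ≤ P.card) {u v : EuclideanSpace ℝ (Fin d)} {η : ℝ}
    (h : ∀ p ∈ P, ⟪u, p⟫ - η ≤ ⟪v, p⟫) : omegaK k u P - η ≤ omegaK k v P := by
  rw [sub_le_iff_le_add]
  refine csSup_le (nonempty_setOf_le_card_filter u hPk) fun s hs => ?_
  rw [← sub_le_iff_le_add]
  refine le_csSup (bddAbove_setOf_le_card_filter hk v P) ?_
  refine le_trans hs (Finset.card_le_card fun p hp => ?_)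
  rw [Finset.mem_filter] at hp ⊢
  exact ⟨hp.1, by linarith [h p hp.1, hp.2]⟩

theorem norm_le_sqrt_of_mem_unitCube {d : ℕ} {p : EuclideanSpace ℝ (Fin d)}
    (hp : ∀ i, 0 ≤ p i ∧ p i ≤ 1) : ‖p‖ ≤ √(d : ℝ) := by
  rw [EuclideanSpace.norm_eq]
  apply Real.sqrt_le_sqrt
  calc ∑ i, ‖p i‖ ^ 2 ≤ ∑ _i : Fin d, (1 : ℝ) := Finset.sum_le_sum fun i _ => by
        rw [Real.norm_of_nonneg (hp i).1]
        exact pow_le_one₀ (hp i).1 (hp i).2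
    _ = d := by simp

/-- **Case 2.** Let `P ⊆ [0,1]^d` be finite with `|P| ≥ k ≥ 1`, let `ε ∈ [0,1]`,
`δ ≥ 0`, `c > 0`, and let `u, ū ∈ 𝕌` with `‖ū − u‖ ≤ δ`.  Suppose `ω_k(u, P) > c/√d` and
suppose `q ∈ P` satisfies `⟨ū, q⟩ ≥ (1−ε)·ω_k(ū, P)`.  Then
`⟨u, q⟩ ≥ (1 − ε − 2dδ/c) · ω_k(u, P)`. -/
theorem regret_bound_large_score_case
    {d : ℕ} (k : ℕ) (hk : 1 ≤ k)
    (P : Finset (EuclideanSpace ℝ (Fin d)))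
    (hPk : k ≤ P.card)
    (hP : ∀ p ∈ P, ∀ i, 0 ≤ p i ∧ p i ≤ 1)
    (ε δ c : ℝ) (hε₀ : 0 ≤ ε) (hε₁ : ε ≤ 1) (hδ : 0 ≤ δ) (hc : 0 < c)
    (u ubar : EuclideanSpace ℝ (Fin d))
    (hu_nonneg : ∀ i, 0 ≤ u i) (hu_norm : ‖u‖ = 1)
    (hubar_nonneg : ∀ i, 0 ≤ ubar i) (hubar_norm : ‖ubar‖ = 1)
    (hdist : ‖ubar - u‖ ≤ δ)
    (hbig : c / Real.sqrt d < omegaK k u P)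
    (q : EuclideanSpace ℝ (Fin d)) (hq : q ∈ P)
    (happrox : (1 - ε) * omegaK k ubar P ≤ ⟪ubar, q⟫) :
    (1 - ε - 2 * d * δ / c) * omegaK k u P ≤ ⟪u, q⟫ := by
  have hscore : ∀ p ∈ P, |⟪ubar, p⟫ - ⟪u, p⟫| ≤ δ * √(d : ℝ) := fun p hp => by
    rw [← inner_sub_left]
    exact (abs_real_inner_le_norm _ _).trans
      (mul_le_mul hdist (norm_le_sqrt_of_mem_unitCube (hP p hp)) (norm_nonneg _) hδ)
  have homega : omegaK k u P - δ * √(d : ℝ) ≤ omegaK k ubar P :=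
    omegaK_sub_le_omegaK hk hPk fun p hp => by linarith [(abs_le.1 (hscore p hp)).1]
  have hqscore := (abs_le.1 (hscore q hq)).2
  have hloss : 0 ≤ δ * √(d : ℝ) := by positivity
  have hgain : 2 * (δ * √(d : ℝ)) ≤ 2 * d * δ / c * omegaK k u P := by
    calc 2 * (δ * √(d : ℝ)) = 2 * d * δ / c * (c / √(d : ℝ)) := by
          rw [show 2 * d * δ / c * (c / √(d : ℝ)) = 2 * (δ * (d / √(d : ℝ))) by field_simp,
            Real.div_sqrt]
      _ ≤ _ := mul_le_mul_of_nonneg_left hbig.le (by positivity)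
  nlinarith [mul_le_mul_of_nonneg_left homega (sub_nonneg.2 hε₁), mul_nonneg hε₀ hloss]
end

section
/- Let P ⊆ [0,1]^d be a finite set with |P| ≥ k ≥ 1, let ε ∈ [0,1] and δ ≥ 0, and let U ⊆ 𝕌 be a finite set that contains the standard basis e_1,…,e_d of ℝ^d and is a δ-net of 𝕌, i.e., for every u ∈ 𝕌 there exists ū ∈ U with ‖u − ū‖ ≤ δ. Let c = min_{i∈{1,…,d}} ω_k(e_i, P) and assume c > 0. Suppose Q ⊆ P is a nonempty set such that for every ū ∈ U there exists q ∈ Q with ⟨ū, q⟩ ≥ (1−ε)·ω_k(ū, P). Then for every u ∈ 𝕌, max_{q∈Q} ⟨u,q⟩ ≥ (1 − ε − 2dδ/c) · ω_k(u, P); that is, the maximum k-regret ratio of Q over P is at most ε + 2dδ/c. -/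
open scoped RealInnerProductSpace Classical

/-- Scores bounded below by an increasing affine function of other scores have a `k`-th largest
value with the same lower bound. -/
theorem omegaK_affine_le {d k : ℕ} (hk : 1 ≤ k) {P : Finset (EuclideanSpace ℝ (Fin d))}
    (hPk : k ≤ P.card) {u v : EuclideanSpace ℝ (Fin d)} {a r : ℝ} (ha : 0 < a)
    (h : ∀ p ∈ P, a * ⟪u, p⟫ - r ≤ ⟪v, p⟫) :
    a * omegaK k u P - r ≤ omegaK k v P := by
  have hne : P.Nonempty := Finset.card_pos.mp (by omega)
  have hbdd : BddAbove {s : ℝ | k ≤ (P.filter (fun p => s ≤ ⟪v, p⟫)).card} := by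
    refine ⟨P.sup' hne (fun p => ⟪v, p⟫), fun s hs => ?_⟩
    obtain ⟨p, hp⟩ := Finset.card_pos.mp (lt_of_lt_of_le hk hs)
    rw [Finset.mem_filter] at hp
    exact hp.2.trans (Finset.le_sup' (fun p => ⟪v, p⟫) hp.1)
  have hle : omegaK k u P ≤ (omegaK k v P + r) / a := by
    refine csSup_le ⟨P.inf' hne (fun p => ⟪u, p⟫), ?_⟩ fun s hs => ?_
    · rw [Set.mem_ofPred_eq,
        Finset.filter_true_of_mem fun p hp => Finset.inf'_le (fun p => ⟪u, p⟫) hp]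
      exact hPk
    · rw [le_div_iff₀ ha]
      have hmem : a * s - r ≤ omegaK k v P := by
        refine le_csSup hbdd (le_trans hs (Finset.card_le_card fun p hp => ?_))
        rw [Finset.mem_filter] at hp ⊢
        exact ⟨hp.1, by nlinarith [h p hp.1, hp.2]⟩
      linarith
  rw [le_div_iff₀ ha] at hle
  linarith

theorem norm_le_sqrt_of_mem_unit_cube {d : ℕ} {p : EuclideanSpace ℝ (Fin d)}
    (hp : ∀ i, 0 ≤ p i ∧ p i ≤ 1) : ‖p‖ ≤ √d := by
  rw [EuclideanSpace.norm_eq]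
  refine Real.sqrt_le_sqrt ?_
  calc ∑ i, ‖p i‖ ^ 2 ≤ ∑ _i : Fin d, (1 : ℝ) := by
        refine Finset.sum_le_sum fun i _ => ?_
        rw [Real.norm_eq_abs, sq_abs]
        nlinarith [hp i]
    _ = d := by simp

/-- A nonnegative unit vector has a coordinate that is at least `1 / √d`. -/
theorem exists_one_le_sqrt_mul_coord {d : ℕ} {u : EuclideanSpace ℝ (Fin d)}
    (hu : ∀ i, 0 ≤ u i) (hnorm : ‖u‖ = 1) : ∃ i, 1 ≤ √d * u i := by
  by_contra! hlt
  have hsum : ∑ i, u i ^ 2 = 1 := by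
    rw [← EuclideanSpace.real_norm_sq_eq, hnorm, one_pow]
  have hne : (Finset.univ : Finset (Fin d)).Nonempty := by
    rw [Finset.nonempty_iff_ne_empty]
    intro h
    simp [h] at hsum
  have hsum_lt : ∑ i, (d : ℝ) * u i ^ 2 < ∑ _i : Fin d, (1 : ℝ) := by
    refine Finset.sum_lt_sum_of_nonempty hne fun i _ => ?_
    have hnn : 0 ≤ √d * u i := mul_nonneg (Real.sqrt_nonneg _) (hu i)
    calc (d : ℝ) * u i ^ 2 = (√d * u i) ^ 2 := by rw [mul_pow, Real.sq_sqrt d.cast_nonneg]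
      _ < 1 := by nlinarith [hlt i]
  rw [← Finset.mul_sum, hsum] at hsum_lt
  simp at hsum_lt

theorem abs_inner_sub_inner_le {d : ℕ} {u v p : EuclideanSpace ℝ (Fin d)} {δ : ℝ}
    (huv : ‖u - v‖ ≤ δ) (hp : ∀ i, 0 ≤ p i ∧ p i ≤ 1) : |⟪u, p⟫ - ⟪v, p⟫| ≤ δ * √d := by
  rw [← inner_sub_left]
  exact (abs_real_inner_le_norm _ _).trans (mul_le_mul huv (norm_le_sqrt_of_mem_unit_cube hp)
    (norm_nonneg _) ((norm_nonneg _).trans huv))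

/-- Let `P ⊆ [0,1]^d` be finite with `|P| ≥ k ≥ 1`, `ε ∈ [0,1]`, `δ ≥ 0`, and
let `Unet ⊆ 𝕌` be a finite set containing the standard basis `e_1, …, e_d` and forming a δ-net
of `𝕌` (for every `u ∈ 𝕌` there is `ū ∈ Unet` with `‖u − ū‖ ≤ δ`).  Let
`c = min_i ω_k(e_i, P) > 0`.  If `Q ⊆ P` is nonempty and for every `ū ∈ Unet` there is `q ∈ Q`
with `⟨ū, q⟩ ≥ (1−ε)·ω_k(ū, P)`, then for every `u ∈ 𝕌`,
`max_{q∈Q} ⟨u,q⟩ ≥ (1 − ε − 2dδ/c)·ω_k(u, P)`; i.e. the maximum `k`-regret ratio of `Q` over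
`P` is at most `ε + 2dδ/c`. -/
theorem delta_net_regret_bound
    {d : ℕ} (hd : 0 < d) (k : ℕ) (hk : 1 ≤ k)
    (P Q : Finset (EuclideanSpace ℝ (Fin d)))
    (hPk : k ≤ P.card)
    (hP : ∀ p ∈ P, ∀ i, 0 ≤ p i ∧ p i ≤ 1)
    (hQP : Q ⊆ P) (hQ : Q.Nonempty)
    (ε δ : ℝ) (hε₀ : 0 ≤ ε) (hε₁ : ε ≤ 1) (hδ : 0 ≤ δ)
    (Unet : Finset (EuclideanSpace ℝ (Fin d)))
    (hUnet : ∀ v ∈ Unet, (∀ i, 0 ≤ v i) ∧ ‖v‖ = 1)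
    (hbasis : ∀ i : Fin d, (EuclideanSpace.single i 1 : EuclideanSpace ℝ (Fin d)) ∈ Unet)
    (hnet : ∀ u : EuclideanSpace ℝ (Fin d), (∀ i, 0 ≤ u i) → ‖u‖ = 1 →
      ∃ v ∈ Unet, ‖u - v‖ ≤ δ)
    (c : ℝ)
    (hc : c = Finset.univ.inf' (Finset.univ_nonempty_iff.mpr ⟨⟨0, hd⟩⟩)
      (fun i => omegaK k (EuclideanSpace.single i 1) P))
    (hcpos : 0 < c)
    (happrox : ∀ v ∈ Unet, ∃ q ∈ Q, (1 - ε) * omegaK k v P ≤ ⟪v, q⟫)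
    (u : EuclideanSpace ℝ (Fin d)) (hu_nonneg : ∀ i, 0 ≤ u i) (hu_norm : ‖u‖ = 1) :
    (1 - ε - 2 * d * δ / c) * omegaK k u P ≤ Q.sup' hQ (fun q => ⟪u, q⟫) := by
  obtain ⟨v, hv, huv⟩ := hnet u hu_nonneg hu_norm
  obtain ⟨q, hq, hvq⟩ := happrox v hv
  obtain ⟨i, hi⟩ := exists_one_le_sqrt_mul_coord hu_nonneg hu_norm
  have hsqrt : 0 < √(d : ℝ) := Real.sqrt_pos.mpr (Nat.cast_pos.mpr hd)
  have hui : 0 < u i := by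
    by_contra! h
    nlinarith
  have hscore : ∀ p ∈ P, u i * ⟪(EuclideanSpace.single i 1 : EuclideanSpace ℝ (Fin d)), p⟫ - 0
      ≤ ⟪u, p⟫ := by
    intro p hp
    have hinner : ⟪u, p⟫ = ∑ j, u j * p j := by simp [PiLp.inner_apply, mul_comm]
    rw [hinner, EuclideanSpace.inner_single_left, map_one, one_mul, sub_zero]
    exact Finset.single_le_sum (f := fun j => u j * p j)
      (fun j _ => mul_nonneg (hu_nonneg j) (hP p hp j).1) (Finset.mem_univ i)
  have hbase := omegaK_affine_le hk hPk hui hscore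
  have hc_le : c ≤ omegaK k (EuclideanSpace.single i 1) P :=
    hc ▸ Finset.inf'_le _ (Finset.mem_univ i)
  have hlower : c ≤ √d * omegaK k u P := by
    have hc_coord : u i * c ≤ omegaK k u P := by nlinarith
    nlinarith
  have hstable := omegaK_affine_le (u := u) (v := v) (r := δ * √d) hk hPk one_pos fun p hp => by
    linarith [(abs_le.mp (abs_inner_sub_inner_le huv (hP p hp))).2]
  have hclose := (abs_le.mp (abs_inner_sub_inner_le huv (hP q (hQP hq)))).1
  have hslack : 2 * (δ * √d) ≤ 2 * d * δ / c * omegaK k u P := by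
    rw [div_mul_eq_mul_div, le_div_iff₀ hcpos]
    calc 2 * (δ * √d) * c ≤ 2 * (δ * √d) * (√d * omegaK k u P) := by gcongr
      _ = 2 * (√d * √d) * δ * omegaK k u P := by ring
      _ = 2 * d * δ * omegaK k u P := by rw [Real.mul_self_sqrt d.cast_nonneg]
  refine le_trans ?_ (Finset.le_sup' (fun q => ⟪u, q⟫) hq)
  have hδd : 0 ≤ δ * √d := by positivity
  have hscaled : (1 - ε) * (1 * omegaK k u P - δ * √d) ≤ (1 - ε) * omegaK k v P :=
    mul_le_mul_of_nonneg_left hstable (sub_nonneg.mpr hε₁)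
  have hεδ : 0 ≤ ε * (δ * √d) := mul_nonneg hε₀ hδd
  linarith
end
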